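/- arXiv:2502.20642 — 4 statements merged into one kernel-verified Lean document; each statement's English description precedes it below -/
import Mathlib

section
/- Let (X, d) be a metric space, let α, β, γ, δ, ε, ζ : X×X → ℝ, and let T : X → X be an (α, β, γ, δ, ε, ζ)-weighted generalized pseudocontraction. Suppose there exists λ : X×X → [0,1] such that for all x, y ∈ X: α_λ(x,y) + ζ_λ(x,y) + 2·min{β_λ(x,y), 0} > 0 and δ_λ(x,y) + ε_λ(x,y) + 2·min{β_λ(x,y), 0} ≥ 0. Then for every x ∈ X the sequence (Tⁿx)_{n∈ℕ} is a Cauchy sequence. -/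
open Filter Topology

/-- `T` is an `(α, β, γ, δ, ε, ζ)`-weighted generalized pseudocontraction. -/
def IsWGPseudocontraction {X : Type*} [MetricSpace X]
    (T : X → X) (α β γ δ ε ζ : X → X → ℝ) : Prop :=
  ∀ x y : X,
    α x y * dist (T x) (T y) ^ 2 + β x y * dist x (T y) ^ 2 +
      γ x y * dist (T x) y ^ 2 + δ x y * dist x y ^ 2 +
      ε x y * dist x (T x) ^ 2 + ζ x y * dist y (T y) ^ 2 ≤ 0

/-- The `l`-weighted combination of two coefficient maps:
`(f, g) ↦ (x, y) ↦ (1 − l(x,y))·f(x,y) + l(x,y)·g(y,x)`.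
With it: `α_λ = wComb l α α`, `β_λ = wComb l β γ`, `γ_λ = wComb l γ β`,
`δ_λ = wComb l δ δ`, `ε_λ = wComb l ε ζ`, `ζ_λ = wComb l ζ ε`. -/
def wComb {X : Type*} (l f g : X → X → ℝ) : X → X → ℝ :=
  fun x y => (1 - l x y) * f x y + l x y * g y x

/-- A weighted generalized pseudocontraction satisfies the inequality with coefficients combined
by any `l` taking values in `[0, 1]`. -/
theorem IsWGPseudocontraction.combine {X : Type*} [MetricSpace X] {T : X → X}
    {α β γ δ ε ζ : X → X → ℝ} (hT : IsWGPseudocontraction T α β γ δ ε ζ)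
    {l : X → X → ℝ} (hl : ∀ x y, l x y ∈ Set.Icc (0 : ℝ) 1) :
    IsWGPseudocontraction T (wComb l α α) (wComb l β γ) (wComb l γ β) (wComb l δ δ)
      (wComb l ε ζ) (wComb l ζ ε) := by
  intro x y
  have hxy := mul_nonpos_of_nonneg_of_nonpos (sub_nonneg.2 (hl x y).2) (hT x y)
  have hyx := mul_nonpos_of_nonneg_of_nonpos (hl x y).1 (hT y x)
  rw [dist_comm (T y) (T x), dist_comm y (T x), dist_comm (T y) x, dist_comm y x] at hyx
  unfold wComb
  linarith

/-- Under sign conditions on the coefficients, a weighted generalized pseudocontraction is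
idempotent. -/
theorem IsWGPseudocontraction.apply_apply {X : Type*} [MetricSpace X] {T : X → X}
    {α β γ δ ε ζ : X → X → ℝ} (hT : IsWGPseudocontraction T α β γ δ ε ζ)
    (h₁ : ∀ x y, 0 < α x y + ζ x y + 2 * min (β x y) 0)
    (h₂ : ∀ x y, 0 ≤ δ x y + ε x y + 2 * min (β x y) 0) (x : X) :
    T (T x) = T x := by
  have hx := hT x (T x)
  rw [dist_self] at hx
  have hsq : dist x (T (T x)) ^ 2 ≤ 2 * dist x (T x) ^ 2 + 2 * dist (T x) (T (T x)) ^ 2 := by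
    have h := pow_le_pow_left₀ dist_nonneg (dist_triangle x (T x) (T (T x))) 2
    linarith [sq_nonneg (dist x (T x) - dist (T x) (T (T x)))]
  have hβ := mul_le_mul_of_nonneg_right (min_le_left (β x (T x)) 0)
    (sq_nonneg (dist x (T (T x))))
  have hm := mul_le_mul_of_nonpos_left hsq (min_le_right (β x (T x)) 0)
  have hδ := mul_nonneg (h₂ x (T x)) (sq_nonneg (dist x (T x)))
  have hle : (α x (T x) + ζ x (T x) + 2 * min (β x (T x)) 0) *
      dist (T x) (T (T x)) ^ 2 ≤ 0 := by
    linarith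
  have hzero : dist (T x) (T (T x)) ^ 2 ≤ 0 := nonpos_of_mul_nonpos_right hle (h₁ x (T x))
  exact (dist_eq_zero.1 (pow_eq_zero_iff two_ne_zero |>.1
    (le_antisymm hzero (sq_nonneg _)))).symm

theorem stmt_2 {X : Type*} [MetricSpace X] (α β γ δ ε ζ : X → X → ℝ)
    (T : X → X) (hT : IsWGPseudocontraction T α β γ δ ε ζ)
    (h : ∃ l : X → X → ℝ, (∀ x y : X, l x y ∈ Set.Icc (0 : ℝ) 1) ∧
      ∀ x y : X,
        0 < wComb l α α x y + wComb l ζ ε x y + 2 * min (wComb l β γ x y) 0 ∧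
        0 ≤ wComb l δ δ x y + wComb l ε ζ x y + 2 * min (wComb l β γ x y) 0) :
    ∀ x : X, CauchySeq (fun n : ℕ => T^[n] x) := by
  obtain ⟨l, hl, hc⟩ := h
  intro x
  have hidem := (hT.combine hl).apply_apply (fun x y => (hc x y).1) (fun x y => (hc x y).2)
  have hconst : ∀ n ≥ 1, T^[n] x = T x := by
    intro n hn
    induction n, hn using Nat.le_induction with
    | base => rfl
    | succ n _ ih => rw [Function.iterate_succ_apply', ih, hidem]
  exact (tendsto_atTop_of_eventually_const hconst).cauchySeq
end

section
/- Let (X, d) be a metric space, let α, β, γ, δ, ε, ζ : X×X → ℝ, and let T : X → X be an (α, β, γ, δ, ε, ζ)-weighted generalized pseudocontraction. Suppose there exists λ : X×X → [0,1] such that for all x, y ∈ X: α_λ(x,y) + ε_λ(x,y) + 2·min{γ_λ(x,y), 0} > 0 and δ_λ(x,y) + ζ_λ(x,y) + 2·min{γ_λ(x,y), 0} ≥ 0. Then for every x ∈ X the sequence (Tⁿx)_{n∈ℕ} is a Cauchy sequence. -/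
open Filter Topology

/-- The defining inequality is inherited by the `l`-weighted combinations of the coefficients. -/
theorem IsWGPseudocontraction.wComb {X : Type*} [MetricSpace X] {T : X → X}
    {α β γ δ ε ζ l : X → X → ℝ} (hT : IsWGPseudocontraction T α β γ δ ε ζ)
    (hl : ∀ x y : X, l x y ∈ Set.Icc (0 : ℝ) 1) :
    IsWGPseudocontraction T (wComb l α α) (wComb l β γ) (wComb l γ β)
      (wComb l δ δ) (wComb l ε ζ) (wComb l ζ ε) := by
  intro x y
  obtain ⟨h0, h1⟩ := hl x y
  have hxy := mul_nonpos_of_nonneg_of_nonpos (sub_nonneg.2 h1) (hT x y)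
  have hyx := mul_nonpos_of_nonneg_of_nonpos h0 (hT y x)
  rw [dist_comm (T y) (T x), dist_comm y (T x), dist_comm (T y) x, dist_comm y x] at hyx
  simp only [_root_.wComb]
  linarith

/-- Under the sign conditions on the coefficients, every value of `T` is a fixed point. -/
theorem IsWGPseudocontraction.map_map_eq {X : Type*} [MetricSpace X] {T : X → X}
    {α β γ δ ε ζ : X → X → ℝ} (hT : IsWGPseudocontraction T α β γ δ ε ζ) {y : X}
    (h₁ : 0 < α (T y) y + ε (T y) y + 2 * min (γ (T y) y) 0)
    (h₂ : 0 ≤ δ (T y) y + ζ (T y) y + 2 * min (γ (T y) y) 0) :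
    T (T y) = T y := by
  have key := hT (T y) y
  rw [dist_self, dist_comm (T y) (T (T y)), dist_comm y (T y)] at key
  set a := dist (T y) y
  set b := dist (T (T y)) (T y) with hb
  set c := dist (T (T y)) y
  set m := min (γ (T y) y) 0
  have hc : c ^ 2 ≤ 2 * (a ^ 2 + b ^ 2) := by
    have htri : c ≤ b + a := dist_triangle _ _ _
    have hc0 : 0 ≤ c := dist_nonneg
    nlinarith [sq_nonneg (a - b), pow_le_pow_left₀ hc0 htri 2]
  have hγ : m * c ^ 2 ≤ γ (T y) y * c ^ 2 :=
    mul_le_mul_of_nonneg_right (min_le_left _ _) (sq_nonneg c)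
  have hm : m * (2 * (a ^ 2 + b ^ 2)) ≤ m * c ^ 2 :=
    mul_le_mul_of_nonpos_left hc (min_le_right _ _)
  have ha := mul_nonneg h₂ (sq_nonneg a)
  have hb_nonpos : (α (T y) y + ε (T y) y + 2 * m) * b ^ 2 ≤ 0 := by linarith
  have hb_sq : b ^ 2 ≤ 0 := nonpos_of_mul_nonpos_right hb_nonpos h₁
  exact dist_eq_zero.1 (pow_eq_zero_iff two_ne_zero |>.1 (le_antisymm hb_sq (sq_nonneg b)))

theorem stmt_4 {X : Type*} [MetricSpace X] (α β γ δ ε ζ : X → X → ℝ)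
    (T : X → X) (hT : IsWGPseudocontraction T α β γ δ ε ζ)
    (h : ∃ l : X → X → ℝ, (∀ x y : X, l x y ∈ Set.Icc (0 : ℝ) 1) ∧
      ∀ x y : X,
        0 < wComb l α α x y + wComb l ε ζ x y + 2 * min (wComb l γ β x y) 0 ∧
        0 ≤ wComb l δ δ x y + wComb l ζ ε x y + 2 * min (wComb l γ β x y) 0) :
    ∀ x : X, CauchySeq (fun n : ℕ => T^[n] x) := by
  obtain ⟨l, hl, hpos⟩ := h
  intro x
  have hfix : Function.IsFixedPt T (T x) :=
    (hT.wComb hl).map_map_eq (hpos (T x) x).1 (hpos (T x) x).2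
  refine Tendsto.cauchySeq (x := T x) (tendsto_const_nhds.congr' ?_)
  filter_upwards [eventually_ge_atTop 1] with n hn
  obtain ⟨k, rfl⟩ := Nat.exists_eq_add_of_le' hn
  rw [Function.iterate_succ_apply]
  exact (hfix.iterate k).symm
end

section
/- Let (X, d) be a metric space, let α, β, γ, δ, ε, ζ : X×X → ℝ, and let T : X → X be an (α, β, γ, δ, ε, ζ)-weighted generalized pseudocontraction. Suppose there exists λ : X×X → [0,1] such that for all x, y ∈ X: α_λ(x,y) + ζ_λ(x,y) + 2·min{β_λ(x,y), 0} > 0 and δ_λ(x,y) + ε_λ(x,y) + 2·min{β_λ(x,y), 0} ≥ 0. Then every point in the image of T is a fixed point of T, i.e., T(Tx) = Tx for all x ∈ X. -/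
open Filter Topology

theorem stmt_12 {X : Type*} [MetricSpace X] (α β γ δ ε ζ : X → X → ℝ)
    (T : X → X) (hT : IsWGPseudocontraction T α β γ δ ε ζ)
    (h : ∃ l : X → X → ℝ, (∀ x y : X, l x y ∈ Set.Icc (0 : ℝ) 1) ∧
      ∀ x y : X,
        0 < wComb l α α x y + wComb l ζ ε x y + 2 * min (wComb l β γ x y) 0 ∧
        0 ≤ wComb l δ δ x y + wComb l ε ζ x y + 2 * min (wComb l β γ x y) 0) :
    ∀ x : X, T (T x) = T x := by
  intro x
  obtain ⟨l, hl, hpos⟩ := h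
  obtain ⟨hb, ha⟩ := hpos x (T x)
  obtain ⟨hl0, hl1⟩ := hl x (T x)
  have h1 := mul_nonpos_of_nonneg_of_nonpos (sub_nonneg.2 hl1) (hT x (T x))
  have h2 := mul_nonpos_of_nonneg_of_nonpos hl0 (hT (T x) x)
  rw [dist_self] at h1 h2
  rw [dist_comm (T (T x)) (T x), dist_comm (T (T x)) x, dist_comm (T x) x] at h2
  have htri : dist x (T (T x)) ≤ dist x (T x) + dist (T x) (T (T x)) := dist_triangle _ _ _
  have hc0 : 0 ≤ dist x (T (T x)) := dist_nonneg
  rw [eq_comm, ← dist_eq_zero]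
  generalize dist x (T x) = a at *
  generalize dist (T x) (T (T x)) = b at *
  generalize dist x (T (T x)) = c at *
  have hsum : (wComb l α α x (T x) + wComb l ζ ε x (T x)) * b ^ 2 +
      wComb l β γ x (T x) * c ^ 2 +
      (wComb l δ δ x (T x) + wComb l ε ζ x (T x)) * a ^ 2 ≤ 0 := by
    simp only [wComb]
    linarith
  have hc : c ^ 2 ≤ 2 * (a ^ 2 + b ^ 2) := by nlinarith [sq_nonneg (a - b)]
  have hm : min (wComb l β γ x (T x)) 0 * (2 * (a ^ 2 + b ^ 2)) ≤
      wComb l β γ x (T x) * c ^ 2 :=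
    (mul_le_mul_of_nonpos_left hc (min_le_right _ _)).trans
      (mul_le_mul_of_nonneg_right (min_le_left _ _) (sq_nonneg c))
  have ha' := mul_nonneg ha (sq_nonneg a)
  by_contra hne
  have hb' := mul_pos hb (sq_pos_iff.2 hne)
  linarith
end

section
/- Let T : ℕ₊ → ℕ₊ (positive integers) be the accelerated Collatz map: T(1) = 1; T(x) = x/2 if x is even; T(x) = (3x+1)/2 if x is odd and x ≥ 3. Equip ℕ₊ with the metric d(x,y) = |x−y|. Define α, β, γ, δ, ε, ζ : ℕ₊×ℕ₊ → ℝ by the following case distinctions on (x,y) (the nine cases are: x=1,y=1; x=1,y even; x=1,y odd ≥3; x even,y=1; x even,y even; x even,y odd ≥3; x odd ≥3,y=1; x odd ≥3,y even; x odd ≥3,y odd ≥3): α takes values 1, 1, 0, 1, 1, 0, 1, 0, 2 respectively; β takes values 0, 0, 0, 0, 0, 0, 0, −2, β₀(x,y) respectively; γ takes values 0, 0, 0, 1, −1, −2, −1, 0, −β₀(x,y) respectively; δ takes values 0, −1, −2, −1, 0, 1, −1, 1, δ₀(x,y) respectively; ε takes values −1, 0, 1, 0, −1, −2, 0, 2,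 ε₀(x,y) respectively; ζ takes values 1, 1, 2, 1, 1, 2, 1, −2, ζ₀(x,y) respectively; where, for x = 2k+1 and y = 2ℓ+1 with k, ℓ ≥ 1: β₀(x,y) = −2 if k−ℓ ≤ −2, β₀(x,y) = k−ℓ if |k−ℓ| ≤ 1, β₀(x,y) = 2 if k−ℓ ≥ 2; δ₀(x,y) = −2 if either (k−ℓ ≤ −2 and 11k−10ℓ+1 ≤ 0) or (k−ℓ ≥ 2 and −10k+11ℓ+1 ≤ 0), and δ₀(x,y) = −1 otherwise; ε₀(x,y) = 2 if k−ℓ ≤ −2 and 11k−10ℓ+1 ≤ 0, and ε₀(x,y) = 0 otherwise; ζ₀(x,y) = 2 if k−ℓ ≥ 2 and −10k+11ℓ+1 ≤ 0, and ζ₀(x,y) = 0 otherwise. Then T is an (α, β, γ, δ, ε, ζ)-weighted generalized pseudocontraction, i.e., for all x, y ∈ ℕ₊: α(x,y)·d(Tx,Ty)² + β(x,y)·d(x,Ty)² + γ(x,y)·d(Tx,y)² + δ(x,y)·d(x,y)² + ε(x,y)·d(x,Tx)² + ζ(x,y)·d(y,Ty)² ≤ 0. -/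
/-- The accelerated Collatz map: `T 1 = 1`, `T x = x / 2` for even `x`,
and `T x = (3x + 1) / 2` for odd `x ≥ 3` (the division is exact). -/
def collatzT (x : ℕ) : ℕ :=
  if x = 1 then 1
  else if x % 2 = 0 then x / 2
  else (3 * x + 1) / 2

/-- For odd `x = 2k+1` and odd `y = 2ℓ+1` (`k, ℓ ≥ 1`), `k` and `ℓ` extracted as integers. -/
def kOf (x : ℕ) : ℤ := ((x : ℤ) - 1) / 2

noncomputable def β₀ (x y : ℕ) : ℝ :=
  if kOf x - kOf y ≤ -2 then -2
  else if 2 ≤ kOf x - kOf y then 2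
  else ((kOf x - kOf y : ℤ) : ℝ)

noncomputable def δ₀ (x y : ℕ) : ℝ :=
  if (kOf x - kOf y ≤ -2 ∧ 11 * kOf x - 10 * kOf y + 1 ≤ 0) ∨
      (2 ≤ kOf x - kOf y ∧ -10 * kOf x + 11 * kOf y + 1 ≤ 0) then -2
  else -1

noncomputable def ε₀ (x y : ℕ) : ℝ :=
  if kOf x - kOf y ≤ -2 ∧ 11 * kOf x - 10 * kOf y + 1 ≤ 0 then 2 else 0

noncomputable def ζ₀ (x y : ℕ) : ℝ :=
  if 2 ≤ kOf x - kOf y ∧ -10 * kOf x + 11 * kOf y + 1 ≤ 0 then 2 else 0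

/-- Case distinction on `(x, y)`: the nine cases
(`x = 1` / `x` even / `x` odd `≥ 3`) × (`y = 1` / `y` even / `y` odd `≥ 3`),
with the given values. -/
noncomputable def byCases₉ (x y : ℕ)
    (a₁₁ a₁e a₁o ae₁ aee aeo ao₁ aoe aoo : ℝ) : ℝ :=
  if x = 1 then (if y = 1 then a₁₁ else if y % 2 = 0 then a₁e else a₁o)
  else if x % 2 = 0 then (if y = 1 then ae₁ else if y % 2 = 0 then aee else aeo)
  else (if y = 1 then ao₁ else if y % 2 = 0 then aoe else aoo)

noncomputable def αC (x y : ℕ) : ℝ := byCases₉ x y 1 1 0 1 1 0 1 0 2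
noncomputable def βC (x y : ℕ) : ℝ := byCases₉ x y 0 0 0 0 0 0 0 (-2) (β₀ x y)
noncomputable def γC (x y : ℕ) : ℝ := byCases₉ x y 0 0 0 1 (-1) (-2) (-1) 0 (-β₀ x y)
noncomputable def δC (x y : ℕ) : ℝ := byCases₉ x y 0 (-1) (-2) (-1) 0 1 (-1) 1 (δ₀ x y)
noncomputable def εC (x y : ℕ) : ℝ := byCases₉ x y (-1) 0 1 0 (-1) (-2) 0 2 (ε₀ x y)
noncomputable def ζC (x y : ℕ) : ℝ := byCases₉ x y 1 1 2 1 1 2 1 (-2) (ζ₀ x y)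

theorem collatzT_one : collatzT 1 = 1 := by simp [collatzT]

theorem collatzT_even (k : ℕ) : collatzT (2 * k) = k := by
  unfold collatzT
  split_ifs <;> omega

theorem collatzT_odd {k : ℕ} (hk : 1 ≤ k) : collatzT (2 * k + 1) = 3 * k + 2 := by
  unfold collatzT
  split_ifs <;> omega

theorem kOf_odd (k : ℕ) : kOf (2 * k + 1) = k := by
  unfold kOf
  push_cast
  omega

theorem eq_one_or_even_or_odd {x : ℕ} (hx : 1 ≤ x) :
    x = 1 ∨ (∃ k, 1 ≤ k ∧ x = 2 * k) ∨ ∃ k, 1 ≤ k ∧ x = 2 * k + 1 := by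
  rcases Nat.even_or_odd' x with ⟨k, rfl | rfl⟩
  · exact Or.inr (Or.inl ⟨k, by omega, rfl⟩)
  · rcases Nat.eq_zero_or_pos k with rfl | hk
    · exact Or.inl rfl
    · exact Or.inr (Or.inr ⟨k, hk, rfl⟩)

/-- The weighted inequality when both arguments are odd and at least `3`. -/
theorem weighted_odd_odd_nonpos {k l : ℕ} (hk : 1 ≤ k) (hl : 1 ≤ l) :
    2 * ((3 * k + 2 : ℝ) - (3 * l + 2)) ^ 2 +
      β₀ (2 * k + 1) (2 * l + 1) * ((2 * k + 1 : ℝ) - (3 * l + 2)) ^ 2 +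
      -β₀ (2 * k + 1) (2 * l + 1) * ((3 * k + 2 : ℝ) - (2 * l + 1)) ^ 2 +
      δ₀ (2 * k + 1) (2 * l + 1) * ((2 * k + 1 : ℝ) - (2 * l + 1)) ^ 2 +
      ε₀ (2 * k + 1) (2 * l + 1) * ((2 * k + 1 : ℝ) - (3 * k + 2)) ^ 2 +
      ζ₀ (2 * k + 1) (2 * l + 1) * ((2 * l + 1 : ℝ) - (3 * l + 2)) ^ 2 ≤ 0 := by
  have hk' : (1 : ℝ) ≤ k := by exact_mod_cast hk
  have hl' : (1 : ℝ) ≤ l := by exact_mod_cast hl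
  simp only [β₀, δ₀, ε₀, ζ₀, kOf_odd]
  rcases le_or_gt ((k : ℤ) - l) (-2) with h | h
  · have h1 : ¬ 2 ≤ (k : ℤ) - l := by omega
    have hr : (k : ℝ) - l ≤ -2 := by exact_mod_cast h
    by_cases hA : 11 * (k : ℤ) - 10 * l + 1 ≤ 0
    · have hAr : 11 * (k : ℝ) - 10 * l + 1 ≤ 0 := by exact_mod_cast hA
      simp only [h, h1, hA, and_self, false_and, or_false, if_true, if_false]
      nlinarith [mul_nonneg (by linarith : (0 : ℝ) ≤ k + 1) (sub_nonneg.2 hAr)]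
    · have hAr : 0 < 11 * (k : ℝ) - 10 * l + 1 := by exact_mod_cast not_le.1 hA
      simp only [h, h1, hA, and_false, false_and, or_false, if_true, if_false]
      nlinarith [mul_nonneg (by linarith : (0 : ℝ) ≤ l - k)
        (by linarith : (0 : ℝ) ≤ 24 * k - 4 * l + 20)]
  · have h1 : ¬ (k : ℤ) - l ≤ -2 := by omega
    rcases le_or_gt 2 ((k : ℤ) - l) with h2 | h2
    · have hr : 2 ≤ (k : ℝ) - l := by exact_mod_cast h2
      by_cases hB : -10 * (k : ℤ) + 11 * l + 1 ≤ 0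
      · have hBr : -10 * (k : ℝ) + 11 * l + 1 ≤ 0 := by exact_mod_cast hB
        simp only [h1, h2, hB, and_self, false_and, false_or, if_true, if_false]
        nlinarith [mul_nonneg (by linarith : (0 : ℝ) ≤ l + 1) (sub_nonneg.2 hBr)]
      · have hBr : 0 < -10 * (k : ℝ) + 11 * l + 1 := by exact_mod_cast not_le.1 hB
        simp only [h1, h2, hB, and_false, false_and, or_false, if_true, if_false]
        nlinarith [mul_nonneg (by linarith : (0 : ℝ) ≤ k - l)
          (by linarith : (0 : ℝ) ≤ 24 * l - 4 * k + 20)]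
    · have h3 : ¬ 2 ≤ (k : ℤ) - l := by omega
      simp only [h1, h3, false_and, or_false, if_false]
      push_cast
      have hd : k = l ∨ k = l + 1 ∨ l = k + 1 := by omega
      rcases hd with rfl | rfl | rfl <;> push_cast <;> nlinarith

/-- `T` is an `(α, β, γ, δ, ε, ζ)`-weighted generalized pseudocontraction on the
positive integers with metric `d(x, y) = |x − y|`. -/
theorem stmt_14 :
    ∀ x y : ℕ, 1 ≤ x → 1 ≤ y →
      αC x y * |(collatzT x : ℝ) - (collatzT y : ℝ)| ^ 2 +
        βC x y * |(x : ℝ) - (collatzT y : ℝ)| ^ 2 +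
        γC x y * |(collatzT x : ℝ) - (y : ℝ)| ^ 2 +
        δC x y * |(x : ℝ) - (y : ℝ)| ^ 2 +
        εC x y * |(x : ℝ) - (collatzT x : ℝ)| ^ 2 +
        ζC x y * |(y : ℝ) - (collatzT y : ℝ)| ^ 2 ≤ 0 := by
  intro x y hx hy
  simp only [sq_abs]
  unfold αC βC γC δC εC ζC byCases₉
  rcases eq_one_or_even_or_odd hx with rfl | ⟨k, hk, rfl⟩ | ⟨k, hk, rfl⟩ <;>
  rcases eq_one_or_even_or_odd hy with rfl | ⟨l, hl, rfl⟩ | ⟨l, hl, rfl⟩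
  case inr.inr.inr.inr =>
    have ek : ¬ 2 * k + 1 = 1 := by omega
    have el : ¬ 2 * l + 1 = 1 := by omega
    have ok : ¬ (2 * k + 1) % 2 = 0 := by omega
    have ol : ¬ (2 * l + 1) % 2 = 0 := by omega
    simp only [ek, el, ok, ol, if_false, collatzT_odd hk, collatzT_odd hl]
    push_cast
    exact weighted_odd_odd_nonpos hk hl
  all_goals
    try have hk' : (1 : ℝ) ≤ k := by exact_mod_cast hk
    try have hl' : (1 : ℝ) ≤ l := by exact_mod_cast hl
    try have ek : ¬ 2 * k + 1 = 1 := by omega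
    try have el : ¬ 2 * l + 1 = 1 := by omega
    try have fk : ¬ 2 * k = 1 := by omega
    try have fl : ¬ 2 * l = 1 := by omega
    try have ok : ¬ (2 * k + 1) % 2 = 0 := by omega
    try have ol : ¬ (2 * l + 1) % 2 = 0 := by omega
    try have pk : (2 * k) % 2 = 0 := by omega
    try have pl : (2 * l) % 2 = 0 := by omega
    simp only [*, if_true, if_false, collatzT_one, collatzT_even, collatzT_odd]
    push_cast
    nlinarith
end
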